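/- arXiv:1311.4634 — 6 statements merged into one kernel-verified Lean document; each statement's English description precedes it below -/
import Mathlib

section
/- Let 1 ≤ K < L be integers, 0 < d_L < d_K < 1, and let v > 0 and ρ ∈ ℝ satisfy −1/(L−1) < ρ < 1 together with the two distortion equations v(1+(K−1)ρ)/(K + v(1+(K−1)ρ)) = d_K and v(1+(L−1)ρ)/(L + v(1+(L−1)ρ)) = d_L. Then the PPR rate equals the K-or-L rate-distortion function for a unit-variance source: R_PPR(K,L,v,ρ) = R_{K,L}(d_K,d_L) with σ² = 1. -/
/-- The K-or-L multiple-description rate-distortion function. -/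
noncomputable def RKL (K L : ℕ) (σ2 dK dL : ℝ) : ℝ :=
  1 / (2 * (K : ℝ)) *
      Real.logb 2 (((L : ℝ) - K) * (σ2 - dL) / ((L : ℝ) * (dK - dL))) +
    1 / (2 * (L : ℝ)) *
      Real.logb 2 ((K : ℝ) * σ2 * (dK - dL) / (((L : ℝ) - K) * dL * (σ2 - dK)))

/-- The PPR per-description coding rate with noise variance `v` and
pairwise correlation coefficient `ρ`. -/
noncomputable def RPPR (K L : ℕ) (v ρ : ℝ) : ℝ :=
  1 / (2 * (K : ℝ)) *
      Real.logb 2 (((K : ℝ) + v * (1 + ((K : ℝ) - 1) * ρ)) / (v * (1 - ρ))) +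
    1 / (2 * (L : ℝ)) *
      Real.logb 2 ((1 - ρ) / (1 + ((L : ℝ) - 1) * ρ))

/-- If the PPR parameters `(v, ρ)` meet the distortion constraints `dK` and
`dL`, then the PPR rate equals the K-or-L rate-distortion function for a
unit-variance source. -/
theorem RPPR_eq_RKL
    (K L : ℕ) (hK : 1 ≤ K) (hKL : K < L)
    (dK dL : ℝ) (hdL : 0 < dL) (hdKdL : dL < dK) (hdK : dK < 1)
    (v ρ : ℝ) (hv : 0 < v) (hρl : -1 / ((L : ℝ) - 1) < ρ) (hρu : ρ < 1)
    (hdKeq : v * (1 + ((K : ℝ) - 1) * ρ) / ((K : ℝ) + v * (1 + ((K : ℝ) - 1) * ρ)) = dK)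
    (hdLeq : v * (1 + ((L : ℝ) - 1) * ρ) / ((L : ℝ) + v * (1 + ((L : ℝ) - 1) * ρ)) = dL) :
    RPPR K L v ρ = RKL K L 1 dK dL := by
  have hK0 : (0 : ℝ) < K := by exact_mod_cast hK
  have hKL0 : (0 : ℝ) < L - K := sub_pos.mpr (by exact_mod_cast hKL)
  have hL1 : (0 : ℝ) < L - 1 := by
    have : (1 : ℝ) ≤ K := by exact_mod_cast hK
    linarith
  have hL0 : (0 : ℝ) < L := by linarith
  have hρ : 0 < 1 - ρ := sub_pos.mpr hρu
  rw [div_lt_iff₀ hL1] at hρl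
  obtain ⟨b, hb⟩ : ∃ b, b = 1 + ((L : ℝ) - 1) * ρ := ⟨_, rfl⟩
  obtain ⟨a, ha⟩ : ∃ a, a = 1 + ((K : ℝ) - 1) * ρ := ⟨_, rfl⟩
  have hab : L * a - K * b = (L - K) * (1 - ρ) := by rw [ha, hb]; ring
  have hb0 : 0 < b := by rw [hb]; linarith
  have ha0 : 0 < a := by
    refine pos_of_mul_pos_right (a := (L : ℝ)) ?_ hL0.le
    linarith [mul_pos hK0 hb0, mul_pos hKL0 hρ]
  have hA : 0 < K + v * a := by positivity
  have hB : 0 < L + v * b := by positivity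
  rw [← ha] at hdKeq
  rw [← hb] at hdLeq
  have hK' : 1 - dK = K / (K + v * a) := by
    rw [← hdKeq]; field_simp; ring
  have hL' : 1 - dL = L / (L + v * b) := by
    rw [← hdLeq]; field_simp; ring
  have hD : dK - dL = v * ((L - K) * (1 - ρ)) / ((K + v * a) * (L + v * b)) := by
    rw [← hdKeq, ← hdLeq, ← hab]; field_simp; ring
  unfold RPPR RKL
  rw [← ha, ← hb, hK', hL', hD, ← hdLeq]
  congr 3 <;> field_simp
end

section
/- Let L ≥ 2 be an integer, v > 0 and −1/(L−1) < ρ < 1. Then there exists a unique pair (s, δ) with s > 0 and δ > 0 satisfying the connection equations v = (s/L)·(δ^{1−L} + (L−1)δ) and ρ·v = −(s/L)·(δ − δ^{1−L}); explicitly, δ = ((1−ρ)/(1+(L−1)ρ))^{1/L} and s = v(1−ρ)/δ. -/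
/-- The connection equations are equivalent to a pair of equations in which the quantizer second
moment multiplies `δ` and `δ ^ (1 - L)` separately. -/
theorem connection_equations_iff {l : ℝ} (hl : l ≠ 0) (v ρ s d e : ℝ) :
    (v = (s / l) * (e + (l - 1) * d) ∧ ρ * v = -(s / l) * (d - e)) ↔
      s * d = v * (1 - ρ) ∧ s * e = v * (1 + (l - 1) * ρ) := by
  constructor
  · rintro ⟨h₁, h₂⟩
    have hs : s / l * l = s := div_mul_cancel₀ s hl
    constructor
    · linear_combination h₂ - h₁ - d * hs
    · linear_combination -h₁ - (l - 1) * h₂ - e * hs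
  · rintro ⟨h₁, h₂⟩
    constructor
    · field_simp
      linear_combination -h₂ - (l - 1) * h₁
    · field_simp
      linear_combination h₁ - h₂

/-- The separated connection equations determine `δ` and `s` explicitly. -/
theorem separated_equations_iff {L : ℕ} (hL : L ≠ 0) {a b s δ : ℝ} (ha : 0 < a) (hb : 0 < b)
    (hδ : 0 < δ) :
    (s * δ = a ∧ s * δ ^ (1 - (L : ℤ)) = b) ↔
      δ = (a / b) ^ ((1 : ℝ) / (L : ℝ)) ∧ s = a / δ := by
  have hpow : δ ^ (1 - (L : ℤ)) = δ / δ ^ L := by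
    rw [zpow_sub₀ hδ.ne', zpow_one, zpow_natCast]
  have hroot : δ = (a / b) ^ ((1 : ℝ) / (L : ℝ)) ↔ δ ^ L = a / b := by
    rw [one_div, Real.eq_rpow_inv hδ.le (div_pos ha hb).le (Nat.cast_ne_zero.mpr hL),
      Real.rpow_natCast]
  rw [hroot, hpow, eq_div_iff hδ.ne', and_comm (a := δ ^ L = a / b)]
  refine and_congr_right fun h => ?_
  rw [← mul_div_assoc, h, div_eq_iff (pow_pos hδ L).ne', eq_div_iff hb.ne', mul_comm b, eq_comm]

/-- Existence, uniqueness and explicit form of the DSQ parameters `(s, δ)`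
(quantizer second moment and noise-shaping parameter) realizing given PPR
parameters `(v, ρ)`. -/
theorem DSQ_parameters_exist_unique
    (L : ℕ) (hL : 2 ≤ L) (v ρ : ℝ) (hv : 0 < v)
    (hρl : -1 / ((L : ℝ) - 1) < ρ) (hρu : ρ < 1) :
    (∃! p : ℝ × ℝ, p.1 > 0 ∧ p.2 > 0 ∧
        v = (p.1 / (L : ℝ)) * (p.2 ^ (1 - (L : ℤ)) + ((L : ℝ) - 1) * p.2) ∧
        ρ * v = -(p.1 / (L : ℝ)) * (p.2 - p.2 ^ (1 - (L : ℤ)))) ∧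
    (∀ s δ : ℝ,
        (s > 0 ∧ δ > 0 ∧
          v = (s / (L : ℝ)) * (δ ^ (1 - (L : ℤ)) + ((L : ℝ) - 1) * δ) ∧
          ρ * v = -(s / (L : ℝ)) * (δ - δ ^ (1 - (L : ℤ)))) →
        δ = ((1 - ρ) / (1 + ((L : ℝ) - 1) * ρ)) ^ ((1 : ℝ) / (L : ℝ)) ∧
        s = v * (1 - ρ) / δ) := by
  have hL₀ : L ≠ 0 := by omega
  have hL₁ : (0 : ℝ) < (L : ℝ) - 1 := by
    have : (2 : ℝ) ≤ L := by exact_mod_cast hL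
    linarith
  have ha : 0 < 1 - ρ := by linarith
  have hb : 0 < 1 + ((L : ℝ) - 1) * ρ := by
    rw [div_lt_iff₀ hL₁] at hρl
    linarith
  have key (s δ : ℝ) (hδ : 0 < δ) :
      (v = (s / (L : ℝ)) * (δ ^ (1 - (L : ℤ)) + ((L : ℝ) - 1) * δ) ∧
          ρ * v = -(s / (L : ℝ)) * (δ - δ ^ (1 - (L : ℤ)))) ↔
        δ = ((1 - ρ) / (1 + ((L : ℝ) - 1) * ρ)) ^ ((1 : ℝ) / (L : ℝ)) ∧
          s = v * (1 - ρ) / δ := by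
    rw [connection_equations_iff (Nat.cast_ne_zero.mpr hL₀),
      separated_equations_iff hL₀ (mul_pos hv ha) (mul_pos hv hb) hδ,
      mul_div_mul_left _ _ hv.ne']
  have hδ := Real.rpow_pos_of_pos (div_pos ha hb) ((1 : ℝ) / (L : ℝ))
  refine ⟨⟨(_, _), ⟨div_pos (mul_pos hv ha) hδ, hδ, (key _ _ hδ).mpr ⟨rfl, rfl⟩⟩, ?_⟩,
    fun s δ h => (key s δ h.2.1).mp h.2.2⟩
  rintro ⟨s, δ⟩ ⟨-, hδ', h⟩
  obtain ⟨rfl, rfl⟩ := (key s δ hδ').mp h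
  rfl
end

section
/- Let L ≥ 2 be an integer, s > 0, δ > 0, and let v, ρ satisfy the connection equations v = (s/L)·(δ^{1−L} + (L−1)δ) and ρ·v = −(s/L)·(δ − δ^{1−L}). Then 1+(L−1)ρ > 0, and (1−ρ)/(1+(L−1)ρ) = δ^L. -/
/-- Under the DSQ–PPR connection equations one has `1 + (L-1)ρ > 0` and
`(1-ρ)/(1+(L-1)ρ) = δ^L`. -/
theorem DSQ_PPR_ratio_eq_delta_pow
    (L : ℕ) (hL : 2 ≤ L) (s δ v ρ : ℝ) (hs : 0 < s) (hδ : 0 < δ)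
    (hv : v = (s / (L : ℝ)) * (δ ^ (1 - (L : ℤ)) + ((L : ℝ) - 1) * δ))
    (hρv : ρ * v = -(s / (L : ℝ)) * (δ - δ ^ (1 - (L : ℤ)))) :
    1 + ((L : ℝ) - 1) * ρ > 0 ∧
    (1 - ρ) / (1 + ((L : ℝ) - 1) * ρ) = δ ^ L := by
  have hL0 : (0 : ℝ) < L := by exact_mod_cast (by omega : 0 < L)
  have hL1 : (0 : ℝ) ≤ (L : ℝ) - 1 := by
    have : (1 : ℝ) ≤ L := by exact_mod_cast (by omega : 1 ≤ L)
    linarith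
  have ha : 0 < δ ^ (1 - (L : ℤ)) := zpow_pos hδ _
  have haδ : δ ^ L * δ ^ (1 - (L : ℤ)) = δ := by
    rw [← zpow_natCast, ← zpow_add₀ hδ.ne']
    simp
  generalize δ ^ (1 - (L : ℤ)) = a at *
  have hv0 : 0 < v := by rw [hv]; positivity
  have hnum : v * (1 - ρ) = s * δ := by
    have : v * (1 - ρ) = v - ρ * v := by ring
    rw [this, hρv, hv]
    field_simp
    ring
  have hden : v * (1 + ((L : ℝ) - 1) * ρ) = s * a := by
    have : v * (1 + ((L : ℝ) - 1) * ρ) = v + ((L : ℝ) - 1) * (ρ * v) := by ring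
    rw [this, hρv, hv]
    field_simp
    ring
  have hpos : 0 < 1 + ((L : ℝ) - 1) * ρ :=
    pos_of_mul_pos_right (hden ▸ mul_pos hs ha) hv0.le
  refine ⟨hpos, ?_⟩
  rw [div_eq_iff hpos.ne']
  apply mul_left_cancel₀ hv0.ne'
  rw [hnum, mul_left_comm, hden, mul_left_comm, haδ]
end

section
/- Let L ≥ 2 be an integer, s > 0, δ > 0, and let v, ρ satisfy the connection equations v = (s/L)·(δ^{1−L} + (L−1)δ) and ρ·v = −(s/L)·(δ − δ^{1−L}). Then for every integer m with 1 ≤ m ≤ L, one has s·(δ^{1−L}/L + (1/m − 1/L)·δ) = v(1+(m−1)ρ)/m, and consequently the DSQ distortion equals the PPR distortion for a unit-variance source: s·(δ^{1−L}/L + (1/m − 1/L)δ) / (1 + s·(δ^{1−L}/L + (1/m − 1/L)δ)) = v(1+(m−1)ρ)/(m + v(1+(m−1)ρ)). -/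
/-- Under the DSQ–PPR connection equations, for every `1 ≤ m ≤ L` the DSQ
noise term equals the PPR noise term, and consequently the DSQ distortion
equals the PPR distortion for a unit-variance source. -/
theorem DSQ_distortion_eq_PPR_distortion
    (L : ℕ) (hL : 2 ≤ L) (s δ v ρ : ℝ) (hs : 0 < s) (hδ : 0 < δ)
    (hv : v = (s / (L : ℝ)) * (δ ^ (1 - (L : ℤ)) + ((L : ℝ) - 1) * δ))
    (hρv : ρ * v = -(s / (L : ℝ)) * (δ - δ ^ (1 - (L : ℤ)))) :
    ∀ m : ℕ, 1 ≤ m → m ≤ L →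
      s * (δ ^ (1 - (L : ℤ)) / (L : ℝ) + (1 / (m : ℝ) - 1 / (L : ℝ)) * δ) =
        v * (1 + ((m : ℝ) - 1) * ρ) / (m : ℝ) ∧
      s * (δ ^ (1 - (L : ℤ)) / (L : ℝ) + (1 / (m : ℝ) - 1 / (L : ℝ)) * δ) /
          (1 + s * (δ ^ (1 - (L : ℤ)) / (L : ℝ) + (1 / (m : ℝ) - 1 / (L : ℝ)) * δ)) =
        v * (1 + ((m : ℝ) - 1) * ρ) / ((m : ℝ) + v * (1 + ((m : ℝ) - 1) * ρ)) := by
  intro m hm _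
  have hm0 : (m : ℝ) ≠ 0 := by positivity
  have hL0 : (L : ℝ) ≠ 0 := by positivity
  have hnoise : s * (δ ^ (1 - (L : ℤ)) / (L : ℝ) + (1 / (m : ℝ) - 1 / (L : ℝ)) * δ) =
      v * (1 + ((m : ℝ) - 1) * ρ) / (m : ℝ) := by
    have hexpand : v * (1 + ((m : ℝ) - 1) * ρ) = v + ((m : ℝ) - 1) * (ρ * v) := by ring
    rw [hexpand, hρv, hv]
    generalize δ ^ (1 - (L : ℤ)) = a
    field_simp
    ring
  refine ⟨hnoise, ?_⟩
  rw [hnoise, one_add_div hm0, div_div_div_cancel_right₀ hm0]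
end

section
/- Let 1 ≤ K < L be integers, s > 0, δ > 0, and let v > 0, ρ with −1/(L−1) < ρ < 1 satisfy the connection equations v = (s/L)·(δ^{1−L} + (L−1)δ) and ρ·v = −(s/L)·(δ − δ^{1−L}). Let Σ be the K×K matrix with Σ_{ii} = 1+v and Σ_{ij} = 1+ρ·v for i ≠ j (the covariance matrix of Y_i = X + V_i for a unit-variance source X and PPR noises V_i). Then (1/(2K))·log₂( det Σ / s^K ) = R_PPR(K,L,v,ρ). -/
/-- The determinant of a matrix with constant diagonal `a + b` and constant off-diagonal `b`. -/
theorem det_smul_one_add_of_const {n F : Type*} [Fintype n] [DecidableEq n] [Field F]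
    {a : F} (ha : a ≠ 0) (b : F) :
    (a • (1 : Matrix n n F) + Matrix.of fun _ _ => b).det =
      a ^ Fintype.card n * ((a + Fintype.card n * b) / a) := by
  have hfactor : a • (1 : Matrix n n F) + (Matrix.of fun _ _ => b) =
      a • (1 + Matrix.replicateCol Unit (fun _ => b / a) *
        Matrix.replicateRow Unit (fun _ => (1 : F))) := by
    ext i j
    simp [Matrix.mul_apply, mul_add, mul_div_cancel₀ b ha]
  rw [hfactor, Matrix.det_smul, Matrix.det_one_add_replicateCol_mul_replicateRow]
  congr 1
  simp [dotProduct]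
  field_simp

/-- Algebraic core of the proof that the Nyquist-sampled DSQ scheme with
random binning achieves the PPR rate: `(1/(2K)) log₂(det Sig / s^K)` equals the
PPR rate, where `Sig` is the covariance matrix of `K` observations
`Y_i = X + V_i` of a unit-variance source. -/
theorem DSQ_RB_rate_eq_PPR_rate
    (K L : ℕ) (hK : 1 ≤ K) (hKL : K < L)
    (s δ v ρ : ℝ) (hs : 0 < s) (hδ : 0 < δ) (hv : 0 < v)
    (hρl : -1 / ((L : ℝ) - 1) < ρ) (hρu : ρ < 1)
    (hveq : v = (s / (L : ℝ)) * (δ ^ (1 - (L : ℤ)) + ((L : ℝ) - 1) * δ))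
    (hρveq : ρ * v = -(s / (L : ℝ)) * (δ - δ ^ (1 - (L : ℤ))))
    (Sig : Matrix (Fin K) (Fin K) ℝ)
    (hSig : ∀ i j, Sig i j = if i = j then 1 + v else 1 + ρ * v) :
    1 / (2 * (K : ℝ)) * Real.logb 2 (Sig.det / s ^ K) = RPPR K L v ρ := by
  have hL : (0 : ℝ) < L := by exact_mod_cast (by omega : 0 < L)
  have hK1 : (1 : ℝ) ≤ K := by exact_mod_cast hK
  have hKL' : (K : ℝ) < L := by exact_mod_cast hKL
  have hsδ : 0 < s * δ := mul_pos hs hδ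
  have hdiff : v * (1 - ρ) = s * δ := by
    rw [mul_one_sub, mul_comm v ρ, hρveq, hveq]
    field_simp
    ring
  have hsum : v * (1 + ((L : ℝ) - 1) * ρ) = s * δ ^ (1 - (L : ℤ)) := by
    have : v * (1 + ((L : ℝ) - 1) * ρ) = v + ((L : ℝ) - 1) * (ρ * v) := by ring
    rw [this, hρveq, hveq]
    field_simp
    ring
  have hratio : (1 - ρ) / (1 + ((L : ℝ) - 1) * ρ) = δ ^ L := by
    rw [← mul_div_mul_left _ _ hv.ne', hdiff, hsum, mul_div_mul_left _ _ hs.ne',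
      zpow_sub₀ hδ.ne', zpow_one, zpow_natCast]
    field_simp
  have hnum : 0 < (K : ℝ) + v * (1 + ((K : ℝ) - 1) * ρ) := by
    have hρ : -1 < ρ * ((L : ℝ) - 1) := (div_lt_iff₀ (by linarith)).mp hρl
    have : 0 < 1 + ((K : ℝ) - 1) * ρ := by
      rcases le_total 0 ρ with h | h <;> nlinarith
    positivity
  have hdet : Sig.det / s ^ K =
      δ ^ K * (((K : ℝ) + v * (1 + ((K : ℝ) - 1) * ρ)) / (v * (1 - ρ))) := by
    have hSig' : Sig = (s * δ) • (1 : Matrix (Fin K) (Fin K) ℝ) +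
        Matrix.of fun _ _ => 1 + ρ * v := by
      ext i j
      rw [hSig, ← hdiff]
      by_cases h : i = j
      · simp [h]
        ring
      · simp [h]
    rw [hSig', det_smul_one_add_of_const hsδ.ne', Fintype.card_fin, ← hdiff,
      show v * (1 - ρ) + K * (1 + ρ * v) = K + v * (1 + ((K : ℝ) - 1) * ρ) by ring, hdiff,
      mul_pow]
    field_simp
  rw [RPPR, hdet, hratio, Real.logb_mul (by positivity)
    (div_pos hnum (hdiff ▸ hsδ)).ne', Real.logb_pow, Real.logb_pow]
  field_simp
  ring
end

section
/- Let L ≥ 2 be an integer, σ² > 0, s > 0 and δ > 0. Then the DSQ distortion d_m = σ²·T_m/(σ² + T_m), where T_m = s·(δ^{1−L}/L + (1/m − 1/L)δ), is strictly decreasing in m on the integers 1 ≤ m ≤ L: for all integers 1 ≤ m < m' ≤ L, d_{m'} < d_m. In particular, in the Nyquist-sampled DSQ scheme the distortion strictly decreases with every additional received description, for any set of received descriptions (no noise amplification). -/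
/-- In the Nyquist-sampled DSQ scheme the distortion
`d_m = σ²T_m/(σ²+T_m)`, `T_m = s(δ^{1-L}/L + (1/m - 1/L)δ)`, strictly
decreases with every additional received description (no noise
amplification). -/
theorem DSQ_distortion_strict_mono
    (L : ℕ) (hL : 2 ≤ L) (σ2 s δ : ℝ) (hσ2 : 0 < σ2) (hs : 0 < s) (hδ : 0 < δ)
    (T d : ℕ → ℝ)
    (hT : ∀ m : ℕ, T m =
      s * (δ ^ (1 - (L : ℤ)) / (L : ℝ) + (1 / (m : ℝ) - 1 / (L : ℝ)) * δ))
    (hd : ∀ m : ℕ, d m = σ2 * T m / (σ2 + T m)) :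
    ∀ m m' : ℕ, 1 ≤ m → m < m' → m' ≤ L → d m' < d m := by
  intro m m' hm hmm' hm'L
  have hm0 : (0 : ℝ) < m := by exact_mod_cast hm
  have hm'0 : (0 : ℝ) < m' := by exact_mod_cast hm.trans hmm'.le
  have hL0 : (0 : ℝ) < L := by exact_mod_cast zero_lt_two.trans_le hL
  have hinv : 1 / (m' : ℝ) < 1 / m :=
    one_div_lt_one_div_of_lt hm0 (by exact_mod_cast hmm')
  have hinvL : 0 ≤ 1 / (m' : ℝ) - 1 / L :=
    sub_nonneg.2 (one_div_le_one_div_of_le hm'0 (by exact_mod_cast hm'L))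
  have hT'0 : 0 < T m' := by
    rw [hT]
    positivity
  have hTlt : T m' < T m := by
    rw [hT, hT]
    gcongr
  have hT0 : 0 < T m := hT'0.trans hTlt
  rw [hd, hd, div_lt_div_iff₀ (by positivity) (by positivity)]
  nlinarith [mul_lt_mul_of_pos_left hTlt (mul_pos hσ2 hσ2)]
end
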